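/- Let q be a prime power and let n, k, s, t be positive integers with n > k ≥ s ≥ t. Suppose F ⊆ M(k,n), X is a t-cover of F of dimension x, and S ∈ M(s,n) is such that X does not t-intersect S (i.e. it is not the case that dim(X ∩ S) ≥ t). Then there exists a flat R in AG(n,q) with S ⊊ R and |F_S| ≤ [x−t+1 1]_q^{dim R − s} · |F_R|, where F_A = {F ∈ F : A ⊆ F} for a flat A. Moreover, if n ≥ x + k − t + 1, then |F_S| ≤ [x−t+1 1]_q · [n−s−1 k−s−1]_q. -/

import Mathlib

open Module Set

/-- Gaussian binomial coefficient `[n k]_q`, as a rational number, via the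
product formula `∏_{0 ≤ i < k} (q^{n-i} - 1)/(q^{k-i} - 1)`. -/
noncomputable def gaussQ (q n k : ℕ) : ℚ :=
  ∏ i ∈ Finset.range k, ((q : ℚ) ^ (n - i) - 1) / ((q : ℚ) ^ (k - i) - 1)

/-- `A` is a `k`-flat of the affine space `AG(n, q)` (with `q = |𝔽|`):
a coset `x + P` of a `k`-dimensional linear subspace `P` of `𝔽^n`. -/
def IsFlat (𝔽 : Type) [Field 𝔽] {n : ℕ} (k : ℕ) (A : Set (Fin n → 𝔽)) : Prop :=
  ∃ (P : Submodule 𝔽 (Fin n → 𝔽)) (x : Fin n → 𝔽),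
    Module.finrank 𝔽 ↥P = k ∧ A = {v | v - x ∈ P}

/-- `A` is a flat (in particular nonempty) of dimension at least `t`. -/
def DimGe (𝔽 : Type) [Field 𝔽] {n : ℕ} (t : ℕ) (A : Set (Fin n → 𝔽)) : Prop :=
  ∃ j, t ≤ j ∧ IsFlat 𝔽 j A

/-- Two families of flats are cross `t`-intersecting. -/
def CrossT (𝔽 : Type) [Field 𝔽] {n : ℕ} (t : ℕ)
    (F1 F2 : Set (Set (Fin n → 𝔽))) : Prop :=
  ∀ A ∈ F1, ∀ B ∈ F2, DimGe 𝔽 t (A ∩ B)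

/-- A pair of families is trivial: some `t`-flat is contained in every member. -/
def TrivialPair (𝔽 : Type) [Field 𝔽] {n : ℕ} (t : ℕ)
    (F1 F2 : Set (Set (Fin n → 𝔽))) : Prop :=
  ∃ T : Set (Fin n → 𝔽), IsFlat 𝔽 t T ∧ (∀ A ∈ F1, T ⊆ A) ∧ (∀ B ∈ F2, T ⊆ B)

/-- `T` is a `t`-cover of the family `F`: `dim (T ∩ A) ≥ t` for all `A ∈ F`. -/
def IsTCover (𝔽 : Type) [Field 𝔽] {n : ℕ} (t : ℕ) (T : Set (Fin n → 𝔽))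
    (F : Set (Set (Fin n → 𝔽))) : Prop :=
  ∀ A ∈ F, DimGe 𝔽 t (T ∩ A)

/-- `τ_t(F)`: the minimum dimension of a `t`-cover of `F`. -/
noncomputable def tauT (𝔽 : Type) [Field 𝔽] {n : ℕ} (t : ℕ)
    (F : Set (Set (Fin n → 𝔽))) : ℕ :=
  sInf {x | ∃ T : Set (Fin n → 𝔽), IsFlat 𝔽 x T ∧ IsTCover 𝔽 t T F}

/-- `A₁(M, T; k, t) = {F ∈ M(k,n) : T ⊆ F, dim(F ∩ M) ≥ t + 1}`. -/
def A1 (𝔽 : Type) [Field 𝔽] {n : ℕ} (M T : Set (Fin n → 𝔽)) (k t : ℕ) :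
    Set (Set (Fin n → 𝔽)) :=
  {F | IsFlat 𝔽 k F ∧ T ⊆ F ∧ DimGe 𝔽 (t + 1) (F ∩ M)}

/-- `A₂(M, T; k, t) = {F ∈ M(k,n) : T ⊆ F} ∪ {F ∈ M(k,n) : F ⊆ M, dim(F ∩ T) = t - 1}`. -/
def A2 (𝔽 : Type) [Field 𝔽] {n : ℕ} (M T : Set (Fin n → 𝔽)) (k t : ℕ) :
    Set (Set (Fin n → 𝔽)) :=
  {F | IsFlat 𝔽 k F ∧ T ⊆ F} ∪ {F | IsFlat 𝔽 k F ∧ F ⊆ M ∧ IsFlat 𝔽 (t - 1) (F ∩ T)}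

/-- `A₃(S; k) = {F ∈ M(k,n) : S ⊆ F}`. -/
def A3 (𝔽 : Type) [Field 𝔽] {n : ℕ} (S : Set (Fin n → 𝔽)) (k : ℕ) :
    Set (Set (Fin n → 𝔽)) :=
  {F | IsFlat 𝔽 k F ∧ S ⊆ F}

/-- `A₄(S; k, t) = {F ∈ M(k,n) : dim(F ∩ S) ≥ t}`. -/
def A4 (𝔽 : Type) [Field 𝔽] {n : ℕ} (S : Set (Fin n → 𝔽)) (k t : ℕ) :
    Set (Set (Fin n → 𝔽)) :=
  {F | IsFlat 𝔽 k F ∧ DimGe 𝔽 t (F ∩ S)}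

/-- Double counting: if every `a ∈ s` is related to at least `m` elements of `t` and every `b ∈ t`
to at most `n` elements of `s`, then `|s| * m ≤ |t| * n`. -/
theorem ncard_mul_le_ncard_mul {α β : Type*} [Finite α] [Finite β] (r : α → β → Prop)
    (s : Set α) (t : Set β) {m n : ℕ} (hm : ∀ a ∈ s, m ≤ {b | b ∈ t ∧ r a b}.ncard)
    (hn : ∀ b ∈ t, {a | a ∈ s ∧ r a b}.ncard ≤ n) : s.ncard * m ≤ t.ncard * n := by
  classical
  have := Fintype.ofFinite α
  have := Fintype.ofFinite β
  rw [ncard_eq_toFinset_card', ncard_eq_toFinset_card']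
  refine Finset.card_mul_le_card_mul r (fun a ha => (hm a (by simpa using ha)).trans_eq ?_)
    (fun b hb => (hn b (by simpa using hb)).trans_eq' ?_)
  · rw [ncard_eq_toFinset_card']
    congr 1
    ext
    simp [Finset.bipartiteAbove]
  · rw [ncard_eq_toFinset_card']
    congr 1
    ext
    simp [Finset.bipartiteBelow]

theorem gaussQ_nonneg {q : ℕ} (hq : 1 ≤ q) (n k : ℕ) : 0 ≤ gaussQ q n k := by
  have h (m : ℕ) : (0 : ℚ) ≤ (q : ℚ) ^ m - 1 :=
    sub_nonneg.2 (one_le_pow₀ (by exact_mod_cast hq))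
  exact Finset.prod_nonneg fun i _ => div_nonneg (h _) (h _)

theorem gaussQ_succ (q n k : ℕ) :
    gaussQ q n (k + 1) = ((q : ℚ) ^ n - 1) / ((q : ℚ) ^ (k + 1) - 1) * gaussQ q (n - 1) k := by
  unfold gaussQ
  rw [Finset.prod_range_succ', mul_comm]
  simp only [Nat.sub_zero, Nat.sub_sub, Nat.add_comm 1, Nat.add_sub_add_right]

theorem gaussQ_one (q n : ℕ) : gaussQ q n 1 = ((q : ℚ) ^ n - 1) / ((q : ℚ) - 1) := by
  simp [gaussQ]

section Counting

variable {K V : Type*} [Field K] [Fintype K] [AddCommGroup V] [Module K V] [Module.Finite K V]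

theorem Submodule.ncard_eq_pow_finrank (P : Submodule K V) :
    (P : Set V).ncard = Fintype.card K ^ finrank K P := by
  have : Finite V := Module.finite_of_finite K
  have := Fintype.ofFinite P
  rw [← Module.card_eq_pow_finrank (K := K), ← Nat.card_coe_set_eq, ← Nat.card_eq_fintype_card]
  rfl

/-- In a space of dimension `N`, at most `[N - p, d]_q` subspaces of dimension `p + d` contain a
given subspace of dimension `p`. -/
theorem ncard_submodules_ge_le_gaussQ (d : ℕ) (P : Submodule K V) :
    ({Q : Submodule K V | P ≤ Q ∧ finrank K Q = finrank K P + d}.ncard : ℚ) ≤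
      gaussQ (Fintype.card K) (finrank K V - finrank K P) d := by
  have : Finite V := Module.finite_of_finite K
  have : Finite (Submodule K V) := Finite.of_injective _ SetLike.coe_injective
  set q := Fintype.card K
  have hq1 : 1 < q := Fintype.one_lt_card
  induction d generalizing P with
  | zero =>
    have h : {Q : Submodule K V | P ≤ Q ∧ finrank K Q = finrank K P + 0} ⊆ {P} :=
      fun Q hQ => (Submodule.eq_of_le_of_finrank_eq hQ.1 hQ.2.symm).symm
    have := ncard_le_ncard h
    rw [ncard_singleton] at this
    simpa [gaussQ] using this
  | succ d ih =>
    set p := finrank K P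
    set N := finrank K V
    have hpN : p ≤ N := Submodule.finrank_le P
    set G := {Q : Submodule K V | P ≤ Q ∧ finrank K Q = p + (d + 1)}
    set B := gaussQ q (N - p - 1) d
    have hB : 0 ≤ B := gaussQ_nonneg hq1.le _ _
    have key : G.ncard * (q ^ (p + (d + 1)) - q ^ p) ≤ (P : Set V)ᶜ.ncard * ⌊B⌋₊ := by
      refine ncard_mul_le_ncard_mul (fun Q v => v ∈ Q) _ _ ?_ ?_
      · rintro Q ⟨hPQ, hQ⟩
        have h : {v | v ∈ (P : Set V)ᶜ ∧ v ∈ Q} = (Q : Set V) \ P := by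
          ext; simp [and_comm]
        rw [h, ncard_sdiff hPQ, Submodule.ncard_eq_pow_finrank, Submodule.ncard_eq_pow_finrank, hQ]
      · intro v hv
        have hv : v ∉ P := hv
        have hr := Submodule.finrank_sup_span_singleton (K := K) hv
        have h := ih (P ⊔ Submodule.span K {v})
        rw [hr, ← Nat.sub_sub] at h
        refine Nat.le_floor (le_trans ?_ h)
        refine Nat.cast_le.2 (ncard_le_ncard ?_)
        rintro Q ⟨⟨hPQ, hQ⟩, hvQ⟩
        exact ⟨sup_le hPQ (by simpa using hvQ), by simp only [hQ]; omega⟩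
    have hc : (P : Set V)ᶜ.ncard = q ^ N - q ^ p := by
      rw [← Submodule.ncard_eq_pow_finrank, compl_eq_univ_sdiff, ncard_sdiff (subset_univ _)]
      congr 1
      rw [ncard_univ, Module.natCard_eq_pow_finrank (K := K), Nat.card_eq_fintype_card]
    rw [hc] at key
    have hqQ : (1 : ℚ) < q := by exact_mod_cast hq1
    have key' : (G.ncard : ℚ) * ((q : ℚ) ^ (p + (d + 1)) - q ^ p) ≤ ((q : ℚ) ^ N - q ^ p) * B := by
      have h1 : q ^ p ≤ q ^ (p + (d + 1)) := Nat.pow_le_pow_right hq1.le (by omega)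
      have h2 : q ^ p ≤ q ^ N := Nat.pow_le_pow_right hq1.le hpN
      have h3 : ((q ^ N - q ^ p : ℕ) : ℚ) * (⌊B⌋₊ : ℚ) ≤ ((q ^ N - q ^ p : ℕ) : ℚ) * B :=
        mul_le_mul_of_nonneg_left (Nat.floor_le hB) (Nat.cast_nonneg _)
      have h4 : ((G.ncard * (q ^ (p + (d + 1)) - q ^ p) : ℕ) : ℚ) ≤
        (((q ^ N - q ^ p) * ⌊B⌋₊ : ℕ) : ℚ) := by exact_mod_cast key
      push_cast [Nat.cast_sub h1, Nat.cast_sub h2] at h3 h4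
      exact h4.trans h3
    rw [gaussQ_succ, div_mul_eq_mul_div, le_div_iff₀ (sub_pos.2 (one_lt_pow₀ hqQ d.add_one_ne_zero))]
    have hp : (0 : ℚ) < (q : ℚ) ^ p := by positivity
    have hN : (q : ℚ) ^ N = q ^ p * q ^ (N - p) := by rw [← pow_add, Nat.add_sub_cancel' hpN]
    rw [hN, pow_add] at key'
    refine le_of_mul_le_mul_left ?_ hp
    change _ ≤ _ * (_ * B)
    linear_combination key'

end Counting

section Flats

variable {𝔽 : Type} [Field 𝔽] {n : ℕ}

theorem IsFlat.exists_submodule {k : ℕ} {A : Set (Fin n → 𝔽)} (hA : IsFlat 𝔽 k A)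
    {p : Fin n → 𝔽} (hp : p ∈ A) :
    ∃ P : Submodule 𝔽 (Fin n → 𝔽), finrank 𝔽 P = k ∧ A = {v | v - p ∈ P} := by
  obtain ⟨P, x, hP, rfl⟩ := hA
  refine ⟨P, hP, ?_⟩
  ext v
  have hp : p - x ∈ P := hp
  have h : v - x = (v - p) + (p - x) := by abel
  simp only [mem_ofPred_eq, h]
  exact Submodule.add_mem_iff_left P hp

theorem IsFlat.nonempty {k : ℕ} {A : Set (Fin n → 𝔽)} (hA : IsFlat 𝔽 k A) : A.Nonempty := by
  obtain ⟨P, x, -, rfl⟩ := hA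
  exact ⟨x, by simp⟩

theorem IsFlat.inter {a b : ℕ} {A B : Set (Fin n → 𝔽)} (hA : IsFlat 𝔽 a A) (hB : IsFlat 𝔽 b B)
    (h : (A ∩ B).Nonempty) : ∃ j, IsFlat 𝔽 j (A ∩ B) := by
  obtain ⟨p, hpA, hpB⟩ := h
  obtain ⟨P, -, rfl⟩ := hA.exists_submodule hpA
  obtain ⟨Q, -, rfl⟩ := hB.exists_submodule hpB
  exact ⟨_, P ⊓ Q, p, rfl, rfl⟩

theorem setOf_sub_mem_subset_iff {P Q : Submodule 𝔽 (Fin n → 𝔽)} {p : Fin n → 𝔽} :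
    {v | v - p ∈ P} ⊆ {v | v - p ∈ Q} ↔ P ≤ Q := by
  refine ⟨fun h v hv => ?_, fun h v hv => h hv⟩
  simpa using @h (v + p) (by simpa using hv)

/-- The span of a flat and a point outside it. -/
theorem IsFlat.exists_insert {s : ℕ} {S : Set (Fin n → 𝔽)} (hS : IsFlat 𝔽 s S)
    {v : Fin n → 𝔽} (hv : v ∉ S) :
    ∃ R, IsFlat 𝔽 (s + 1) R ∧ S ⊂ R ∧
      ∀ k A, IsFlat 𝔽 k A → S ⊆ A → v ∈ A → R ⊆ A := by
  obtain ⟨p, hp⟩ := hS.nonempty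
  obtain ⟨P, rfl, rfl⟩ := hS.exists_submodule hp
  have hv : v - p ∉ P := hv
  have hvR : v ∈ {w | w - p ∈ P ⊔ Submodule.span 𝔽 {v - p}} :=
    Submodule.mem_sup_right (Submodule.mem_span_singleton_self (v - p))
  refine ⟨{w | w - p ∈ P ⊔ Submodule.span 𝔽 {v - p}},
    ⟨_, p, Submodule.finrank_sup_span_singleton hv, rfl⟩,
    ⟨setOf_sub_mem_subset_iff.2 le_sup_left, fun h => hv (h hvR)⟩, ?_⟩
  intro k A hA hPA hvA
  obtain ⟨Q, -, rfl⟩ := hA.exists_submodule (hPA hp)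
  exact setOf_sub_mem_subset_iff.2
    (sup_le (setOf_sub_mem_subset_iff.1 hPA) (by simpa using hvA))

variable [Fintype 𝔽]

theorem IsFlat.ncard_eq {k : ℕ} {A : Set (Fin n → 𝔽)} (hA : IsFlat 𝔽 k A) :
    A.ncard = Fintype.card 𝔽 ^ k := by
  obtain ⟨P, x, rfl, rfl⟩ := hA
  rw [← Submodule.ncard_eq_pow_finrank]
  have h : {v | v - x ∈ P} = Set.image (fun v => v + x) P := by
    ext v; simp [sub_eq_add_neg]
  rw [h, ncard_image_of_injective _ (add_left_injective x)]

theorem DimGe.pow_le_ncard {t : ℕ} {A : Set (Fin n → 𝔽)} (hA : DimGe 𝔽 t A) :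
    Fintype.card 𝔽 ^ t ≤ A.ncard := by
  obtain ⟨j, hj, h⟩ := hA
  rw [h.ncard_eq]
  exact Nat.pow_le_pow_right Fintype.card_pos hj

theorem ncard_inter_mul_card_le {a b t : ℕ} {A B : Set (Fin n → 𝔽)} (hA : IsFlat 𝔽 a A)
    (hB : IsFlat 𝔽 b B) (h : ¬ DimGe 𝔽 t (A ∩ B)) :
    (A ∩ B).ncard * Fintype.card 𝔽 ≤ Fintype.card 𝔽 ^ t := by
  rcases (A ∩ B).eq_empty_or_nonempty with h0 | h0
  · simp [h0]
  · obtain ⟨j, hj⟩ := hA.inter hB h0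
    rw [hj.ncard_eq, ← pow_succ]
    refine Nat.pow_le_pow_right Fintype.card_pos ?_
    by_contra! hlt
    exact h ⟨j, by omega, hj⟩

theorem ncard_flats_ge_le_gaussQ {k r : ℕ} {F : Set (Set (Fin n → 𝔽))}
    (hF : ∀ A ∈ F, IsFlat 𝔽 k A) {R : Set (Fin n → 𝔽)} (hR : IsFlat 𝔽 r R) :
    ({A | A ∈ F ∧ R ⊆ A}.ncard : ℚ) ≤ gaussQ (Fintype.card 𝔽) (n - r) (k - r) := by
  obtain ⟨p, hp⟩ := hR.nonempty
  obtain ⟨P, rfl, rfl⟩ := hR.exists_submodule hp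
  have : Finite (Submodule 𝔽 (Fin n → 𝔽)) := Finite.of_injective _ SetLike.coe_injective
  have h := ncard_submodules_ge_le_gaussQ (k - finrank 𝔽 P) P
  rw [Module.finrank_fin_fun] at h
  refine le_trans (Nat.cast_le.2 ?_) h
  refine le_trans (ncard_le_ncard ?_) (ncard_image_le (f := fun Q => {v | v - p ∈ Q}))
  rintro A ⟨hA, hPA⟩
  obtain ⟨Q, hQ, rfl⟩ := (hF A hA).exists_submodule (hPA hp)
  have hPQ := setOf_sub_mem_subset_iff.1 hPA
  have := Submodule.finrank_mono hPQ
  exact ⟨Q, ⟨hPQ, by omega⟩, rfl⟩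

/-- If a `t`-cover `X` of `F` does not `t`-intersect `S`, then some flat of dimension one more than
`S` lies in a large proportion of the members of `F` containing `S`. -/
theorem exists_flat_ncard_le {k s t x : ℕ} {F : Set (Set (Fin n → 𝔽))}
    (hF : ∀ A ∈ F, IsFlat 𝔽 k A) {X : Set (Fin n → 𝔽)} (hX : IsFlat 𝔽 x X)
    (hXF : IsTCover 𝔽 t X F) {S : Set (Fin n → 𝔽)} (hS : IsFlat 𝔽 s S)
    (hXS : ¬ DimGe 𝔽 t (X ∩ S)) (hne : {A | A ∈ F ∧ S ⊆ A}.Nonempty) :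
    ∃ R, IsFlat 𝔽 (s + 1) R ∧ S ⊂ R ∧
      ({A | A ∈ F ∧ S ⊆ A}.ncard : ℚ) ≤
        gaussQ (Fintype.card 𝔽) (x - t + 1) 1 * {A | A ∈ F ∧ R ⊆ A}.ncard := by
  set q := Fintype.card 𝔽
  have hq1 : 1 < q := Fintype.one_lt_card
  have hcq : (X ∩ S).ncard * q ≤ q ^ t := ncard_inter_mul_card_le hX hS hXS
  have hXc : X.ncard = q ^ x := hX.ncard_eq
  have hct : (X ∩ S).ncard < q ^ t := by
    have : 0 < q ^ t := by positivity
    nlinarith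
  have hlow : ∀ A ∈ {A | A ∈ F ∧ S ⊆ A},
      q ^ t - (X ∩ S).ncard ≤ {v | v ∈ X \ S ∧ v ∈ A}.ncard := by
    rintro A ⟨hA, hSA⟩
    have h : {v | v ∈ X \ S ∧ v ∈ A} = (X ∩ A) \ (X ∩ S) := by
      ext v; simp only [mem_ofPred_eq, mem_sdiff, mem_inter_iff]; tauto
    rw [h, ncard_sdiff (inter_subset_inter_right X hSA)]
    exact Nat.sub_le_sub_right (hXF A hA).pow_le_ncard _
  have htx : t ≤ x := by
    obtain ⟨A, hA, -⟩ := hne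
    have h := (hXF A hA).pow_le_ncard.trans (ncard_le_ncard inter_subset_left)
    rw [hXc] at h
    exact (Nat.pow_le_pow_iff_right hq1).1 h
  have hXS_ne : (X \ S).Nonempty := by
    obtain ⟨A, hA⟩ := hne
    have h := hlow A hA
    obtain ⟨v, hv, -⟩ : {v | v ∈ X \ S ∧ v ∈ A}.Nonempty :=
      nonempty_of_ncard_ne_zero (by omega)
    exact ⟨v, hv⟩
  obtain ⟨v, hv, hmax⟩ := (toFinite (X \ S)).exists_maximalFor
    (fun v => {A | A ∈ {A | A ∈ F ∧ S ⊆ A} ∧ v ∈ A}.ncard) _ hXS_ne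
  have key := ncard_mul_le_ncard_mul (fun A v => v ∈ A) _ (X \ S) hlow
    (fun w hw => (le_total _ _).elim id (hmax hw))
  obtain ⟨R, hR, hSR, hRmin⟩ := hS.exists_insert hv.2
  refine ⟨R, hR, hSR, ?_⟩
  set M := {A | A ∈ {A | A ∈ F ∧ S ⊆ A} ∧ v ∈ A}.ncard
  have hM : M ≤ {A | A ∈ F ∧ R ⊆ A}.ncard :=
    ncard_le_ncard fun A hA => ⟨hA.1.1, hRmin k A (hF A hA.1.1) hA.1.2 hA.2⟩
  refine le_trans ?_ (mul_le_mul_of_nonneg_left (Nat.cast_le.2 hM) (gaussQ_nonneg hq1.le _ _))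
  have hcX : (X ∩ S).ncard ≤ q ^ x := hXc ▸ ncard_le_ncard inter_subset_left
  have hd : (X \ S).ncard = q ^ x - (X ∩ S).ncard := by
    rw [← sdiff_self_inter, ncard_sdiff inter_subset_left, hXc]
  rw [hd] at key
  set g := {A | A ∈ F ∧ S ⊆ A}.ncard
  set c := (X ∩ S).ncard
  obtain ⟨y, rfl⟩ := Nat.exists_eq_add_of_le htx
  have key' : (g : ℚ) * ((q : ℚ) ^ t - c) ≤ ((q : ℚ) ^ (t + y) - c) * M := by
    have h : ((g * (q ^ t - c) : ℕ) : ℚ) ≤ (((q ^ (t + y) - c) * M : ℕ) : ℚ) := by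
      exact_mod_cast key
    push_cast [Nat.cast_sub hct.le, Nat.cast_sub hcX] at h
    exact h
  have hqQ : (1 : ℚ) < q := by exact_mod_cast hq1
  have hctQ : (c : ℚ) < (q : ℚ) ^ t := by exact_mod_cast hct
  have hcqQ : (c : ℚ) * q ≤ (q : ℚ) ^ t := by exact_mod_cast hcq
  have ha : (1 : ℚ) ≤ (q : ℚ) ^ y := one_le_pow₀ hqQ.le
  have ratio : ((q : ℚ) ^ (t + y) - c) * (q - 1) ≤ ((q : ℚ) ^ (y + 1) - 1) * ((q : ℚ) ^ t - c) := by
    rw [pow_add, pow_succ]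
    nlinarith [mul_nonneg (sub_nonneg.2 ha) (sub_nonneg.2 hcqQ)]
  rw [gaussQ_one, Nat.add_sub_cancel_left, div_mul_eq_mul_div, le_div_iff₀ (by linarith)]
  refine le_of_mul_le_mul_right ?_ (sub_pos.2 hctQ)
  calc (g : ℚ) * (q - 1) * ((q : ℚ) ^ t - c)
      = (g * ((q : ℚ) ^ t - c)) * (q - 1) := by ring
    _ ≤ (((q : ℚ) ^ (t + y) - c) * M) * (q - 1) :=
        mul_le_mul_of_nonneg_right key' (by linarith)
    _ = (((q : ℚ) ^ (t + y) - c) * (q - 1)) * M := by ring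
    _ ≤ (((q : ℚ) ^ (y + 1) - 1) * ((q : ℚ) ^ t - c)) * M :=
        mul_le_mul_of_nonneg_right ratio (Nat.cast_nonneg _)
    _ = _ := by ring

end Flats

theorem stmt_10 (q : ℕ) (hq : IsPrimePow q)
    (𝔽 : Type) [Field 𝔽] [Fintype 𝔽] (hcard : Fintype.card 𝔽 = q)
    (n k s t x : ℕ) (ht : 0 < t) (hts : t ≤ s) (hsk : s ≤ k) (hkn : k < n)
    (F : Set (Set (Fin n → 𝔽))) (hF : ∀ A ∈ F, IsFlat 𝔽 k A)
    (X : Set (Fin n → 𝔽)) (hX : IsFlat 𝔽 x X) (hXcov : IsTCover 𝔽 t X F)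
    (S : Set (Fin n → 𝔽)) (hS : IsFlat 𝔽 s S)
    (hXS : ¬ DimGe 𝔽 t (X ∩ S)) :
    (∃ (R : Set (Fin n → 𝔽)) (r : ℕ), IsFlat 𝔽 r R ∧ S ⊂ R ∧
      ({A | A ∈ F ∧ S ⊆ A}.ncard : ℚ)
        ≤ gaussQ q (x - t + 1) 1 ^ (r - s) * {A | A ∈ F ∧ R ⊆ A}.ncard) ∧
    (x + k - t + 1 ≤ n →
      ({A | A ∈ F ∧ S ⊆ A}.ncard : ℚ)
        ≤ gaussQ q (x - t + 1) 1 * gaussQ q (n - s - 1) (k - s - 1)) := by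
  subst hcard
  have hq1 : 1 ≤ Fintype.card 𝔽 := Fintype.card_pos
  rcases {A | A ∈ F ∧ S ⊆ A}.eq_empty_or_nonempty with h0 | hne
  · rw [h0, ncard_empty, Nat.cast_zero]
    have hSne : S ≠ univ := by
      rintro rfl
      obtain ⟨p, hp⟩ := hS.nonempty
      obtain ⟨P, hP, hPS⟩ := hS.exists_submodule hp
      have hle : (⊤ : Submodule 𝔽 (Fin n → 𝔽)) ≤ P :=
        (setOf_sub_mem_subset_iff (p := p)).1 (hPS ▸ subset_univ _)
      have := Submodule.finrank_mono hle
      rw [finrank_top, Module.finrank_fin_fun] at this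
      omega
    obtain ⟨v, hv⟩ := (ne_univ_iff_exists_notMem S).1 hSne
    obtain ⟨R, hR, hSR, -⟩ := hS.exists_insert hv
    exact ⟨⟨R, _, hR, hSR, mul_nonneg (pow_nonneg (gaussQ_nonneg hq1 _ _) _) (Nat.cast_nonneg _)⟩,
      fun _ => mul_nonneg (gaussQ_nonneg hq1 _ _) (gaussQ_nonneg hq1 _ _)⟩
  · obtain ⟨R, hR, hSR, h⟩ := exists_flat_ncard_le hF hX hXcov hS hXS hne
    refine ⟨⟨R, s + 1, hR, hSR, by simpa using h⟩, fun _ => h.trans ?_⟩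
    rw [Nat.sub_sub, Nat.sub_sub]
    exact mul_le_mul_of_nonneg_left (ncard_flats_ge_le_gaussQ hF hR) (gaussQ_nonneg hq1 _ _)
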